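/- Let d ≥ 2 be an integer and r > 0. Then ∫₀^∞ |s · (d/ds) m(sr)|² ds/s = (2/π) Γ((d+1)/2)² / ((d−1) Γ(d/2)²), and in particular this quantity is at most 1/2. -/

import Mathlib

open MeasureTheory Real Filter Finset

/-- Bessel function of the first kind of order `α`, via the Poisson integral representation. -/
noncomputable def besselJ (α : ℝ) (t : ℝ) : ℝ :=
  ((t / 2) ^ α / (Real.sqrt π * Real.Gamma (α + 1 / 2))) *
    ∫ θ in (0:ℝ)..π, Real.cos (t * Real.cos θ) * Real.sin θ ^ (2 * α)

/-- The multiplier `m`, defined by an improper integral (as a limit of interval integrals). -/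
noncomputable def mfun (d : ℕ) (x : ℝ) : ℝ :=
  (2 ^ ((d : ℝ) / 2) * Real.Gamma (((d : ℝ) + 1) / 2) / Real.sqrt π) *
    limUnder Filter.atTop
      (fun R : ℝ => ∫ r in (2 * π * x)..R, r ^ (-(d : ℝ) / 2) * besselJ ((d : ℝ) / 2) r)

/-- The Poisson integral `∫₀^π cos (t cos θ) sinⁿ θ dθ`, which is `t ^ (-n/2) J_{n/2}(t)` up to a
constant. -/
noncomputable def poissonIntegral (n : ℕ) (t : ℝ) : ℝ :=
  ∫ θ in (0:ℝ)..π, Real.cos (t * Real.cos θ) * Real.sin θ ^ n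

lemma hasDerivAt_integral_cos_mul_cos {w : ℝ → ℝ} (hw : Continuous w) (t : ℝ) :
    HasDerivAt (fun t : ℝ => ∫ θ in (0:ℝ)..π, Real.cos (t * Real.cos θ) * w θ)
      (∫ θ in (0:ℝ)..π, -(Real.sin (t * Real.cos θ) * (Real.cos θ * w θ))) t := by
  refine (intervalIntegral.hasDerivAt_integral_of_dominated_loc_of_deriv_le
    (F := fun t θ => Real.cos (t * Real.cos θ) * w θ)
    (F' := fun t θ => -(Real.sin (t * Real.cos θ) * (Real.cos θ * w θ)))
    (bound := fun θ => |w θ|) (s := Set.univ) univ_mem ?_ ?_ ?_ ?_ ?_ ?_).2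
  · exact Eventually.of_forall fun x => (by fun_prop : Continuous _).aestronglyMeasurable
  · exact (by fun_prop : Continuous _).intervalIntegrable _ _
  · exact (by fun_prop : Continuous _).aestronglyMeasurable
  · refine ae_of_all _ fun θ _ x _ => ?_
    rw [norm_neg, Real.norm_eq_abs, abs_mul, abs_mul, ← mul_assoc]
    exact mul_le_of_le_one_left (abs_nonneg _)
      (mul_le_one₀ (Real.abs_sin_le_one _) (abs_nonneg _) (Real.abs_cos_le_one _))
  · exact (by fun_prop : Continuous _).intervalIntegrable _ _
  · refine ae_of_all _ fun θ _ x _ => ?_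
    refine (((hasDerivAt_mul_const (Real.cos θ)).cos).mul_const (w θ)).congr_deriv ?_
    ring

lemma hasDerivAt_cos_mul_cos (t θ : ℝ) :
    HasDerivAt (fun θ => Real.cos (t * Real.cos θ))
      (t * (Real.sin (t * Real.cos θ) * Real.sin θ)) θ := by
  refine ((Real.hasDerivAt_cos θ).const_mul t).cos.congr_deriv ?_
  ring

lemma hasDerivAt_sin_mul_cos (t θ : ℝ) :
    HasDerivAt (fun θ => Real.sin (t * Real.cos θ))
      (-(t * (Real.cos (t * Real.cos θ) * Real.sin θ))) θ := by
  refine ((Real.hasDerivAt_cos θ).const_mul t).sin.congr_deriv ?_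
  ring

lemma hasDerivAt_sin_pow_succ (n : ℕ) (θ : ℝ) :
    HasDerivAt (fun θ => Real.sin θ ^ (n + 1)) ((n + 1) * Real.sin θ ^ n * Real.cos θ) θ := by
  exact ((Real.hasDerivAt_sin θ).fun_pow (n + 1)).congr_deriv (by simp)

lemma integral_sin_mul_cos_mul_cos_mul_sin_pow (n : ℕ) (t : ℝ) :
    ((n : ℝ) + 1) * ∫ θ in (0:ℝ)..π, -(Real.sin (t * Real.cos θ) * (Real.cos θ * Real.sin θ ^ n)) =
      -(t * poissonIntegral (n + 2) t) := by
  have h := intervalIntegral.integral_eq_sub_of_hasDerivAt (a := 0) (b := π)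
    (fun θ _ => (hasDerivAt_sin_mul_cos t θ).mul (hasDerivAt_sin_pow_succ n θ))
    ((by fun_prop : Continuous _).intervalIntegrable _ _)
  simp only [Pi.mul_apply, Real.sin_pi, Real.sin_zero, ne_eq, Nat.add_eq_zero_iff, one_ne_zero,
    and_false, not_false_eq_true, zero_pow, mul_zero, sub_zero] at h
  rw [poissonIntegral, ← intervalIntegral.integral_const_mul, ← intervalIntegral.integral_const_mul,
    ← intervalIntegral.integral_neg, ← sub_eq_zero, ← intervalIntegral.integral_sub
      ((by fun_prop : Continuous _).intervalIntegrable _ _)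
      ((by fun_prop : Continuous _).intervalIntegrable _ _), ← neg_eq_zero,
    ← intervalIntegral.integral_neg, ← h]
  congr 1 with θ
  ring

lemma hasDerivAt_poissonIntegral (n : ℕ) (t : ℝ) :
    HasDerivAt (poissonIntegral n) (-(t * poissonIntegral (n + 2) t) / (n + 1)) t := by
  refine (hasDerivAt_integral_cos_mul_cos (w := fun θ => Real.sin θ ^ n)
    (by fun_prop) t).congr_deriv ?_
  rw [← integral_sin_mul_cos_mul_cos_mul_sin_pow]
  field_simp

lemma continuous_poissonIntegral (n : ℕ) : Continuous (poissonIntegral n) :=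
  continuous_iff_continuousAt.2 fun t => (hasDerivAt_poissonIntegral n t).continuousAt

lemma mul_integral_sin_mul_cos_mul_cos_mul_sin_pow (n : ℕ) (t : ℝ) :
    t * ∫ θ in (0:ℝ)..π, -(Real.sin (t * Real.cos θ) * (Real.cos θ * Real.sin θ ^ (n + 2))) =
      (n + 1) * poissonIntegral n t - (n + 2) * poissonIntegral (n + 2) t := by
  have h := intervalIntegral.integral_eq_sub_of_hasDerivAt (a := 0) (b := π)
    (fun θ _ => (hasDerivAt_cos_mul_cos t θ).mul
      ((hasDerivAt_sin_pow_succ n θ).mul (Real.hasDerivAt_cos θ)))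
    ((by fun_prop : Continuous _).intervalIntegrable _ _)
  simp only [Pi.mul_apply, Real.sin_pi, Real.sin_zero, ne_eq, Nat.add_eq_zero_iff, one_ne_zero,
    and_false, not_false_eq_true, zero_pow, mul_zero, zero_mul, sub_zero] at h
  rw [poissonIntegral, poissonIntegral, ← intervalIntegral.integral_const_mul,
    ← intervalIntegral.integral_const_mul, ← intervalIntegral.integral_const_mul,
    ← intervalIntegral.integral_sub
      ((by fun_prop : Continuous _).intervalIntegrable _ _)
      ((by fun_prop : Continuous _).intervalIntegrable _ _), eq_comm, ← sub_eq_zero,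
    ← intervalIntegral.integral_sub
      ((by fun_prop : Continuous _).intervalIntegrable _ _)
      ((by fun_prop : Continuous _).intervalIntegrable _ _), ← h]
  congr 1 with θ
  linear_combination (-(n + 1) * Real.cos (t * Real.cos θ) * Real.sin θ ^ n) *
    Real.sin_sq_add_cos_sq θ

/-- The recurrence `(t ^ (n + 2) P_{n+2}(t))' = (n + 1) t ^ (n + 1) P_n(t)` in terms of Poisson
integrals, written without the powers of `t`. -/
lemma hasDerivAt_mul_poissonIntegral (n : ℕ) (t : ℝ) :
    HasDerivAt (fun t => t * poissonIntegral (n + 2) t)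
      ((n + 1) * poissonIntegral n t - (n + 1) * poissonIntegral (n + 2) t) t := by
  have h := hasDerivAt_integral_cos_mul_cos (w := fun θ => Real.sin θ ^ (n + 2)) (by fun_prop) t
  refine ((hasDerivAt_id t).mul h).congr_deriv ?_
  rw [id, mul_integral_sin_mul_cos_mul_cos_mul_sin_pow, poissonIntegral, poissonIntegral]
  ring

/-- The Riemann–Lebesgue lemma for the phase `cos θ` on `[0, π]`. -/
lemma tendsto_integral_cexp_mul_cos (w : ℝ → ℝ) :
    Tendsto (fun t : ℝ => ∫ θ in (0:ℝ)..π, Complex.exp (t * Real.cos θ * Complex.I) * w θ)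
      atTop (nhds 0) := by
  set S : Set ℝ := Real.cos '' Set.Ioo 0 π
  have hinj : Set.InjOn Real.cos (Set.Ioo 0 π) := Real.injOn_cos.mono Set.Ioo_subset_Icc_self
  have hS : MeasurableSet S :=
    measurableSet_Ioo.image_of_continuousOn_injOn Real.continuous_cos.continuousOn hinj
  have h := Real.tendsto_integral_exp_smul_cocompact
    (S.indicator fun u => ((w (Real.arccos u) / Real.sin (Real.arccos u) : ℝ) : ℂ))
  have hlim : Tendsto (fun t : ℝ => -t / (2 * π)) atTop (cocompact ℝ) :=
    ((tendsto_neg_atTop_atBot.atBot_div_const (by positivity)).mono_right atBot_le_cocompact)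
  refine (h.comp hlim).congr fun t => ?_
  simp only [Function.comp]
  have h1 : ∀ v : ℝ, Real.fourierChar (-(v * (-t / (2 * π)))) •
      S.indicator (fun u => ((w (Real.arccos u) / Real.sin (Real.arccos u) : ℝ) : ℂ)) v =
      S.indicator (fun u => Real.fourierChar (-(u * (-t / (2 * π)))) •
        ((w (Real.arccos u) / Real.sin (Real.arccos u) : ℝ) : ℂ)) v := by
    intro v
    by_cases hv : v ∈ S <;> simp [hv]
  simp_rw [h1]
  rw [integral_indicator hS, integral_image_eq_integral_abs_deriv_smul measurableSet_Ioo
    (fun θ _ => (Real.hasDerivAt_cos θ).hasDerivWithinAt) hinj,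
    intervalIntegral.integral_of_le pi_pos.le, integral_Ioc_eq_integral_Ioo]
  refine setIntegral_congr_fun measurableSet_Ioo fun θ hθ => ?_
  have hs := Real.sin_pos_of_mem_Ioo hθ
  simp only [Real.arccos_cos hθ.1.le hθ.2.le, abs_neg, abs_of_pos hs, Circle.smul_def,
    Real.fourierChar_apply, smul_eq_mul, Complex.real_smul]
  have e : (2 * π * -(Real.cos θ * (-t / (2 * π))) : ℝ) = t * Real.cos θ := by
    field_simp
  have hs' : (Real.sin θ : ℂ) ≠ 0 := by exact_mod_cast hs.ne'
  rw [e, Complex.ofReal_div, Complex.ofReal_mul]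
  field_simp

lemma integral_cexp_mul_cos_eq {w : ℝ → ℝ} (hw : Continuous w) (t : ℝ) :
    ∫ θ in (0:ℝ)..π, Complex.exp (t * Real.cos θ * Complex.I) * w θ =
      (∫ θ in (0:ℝ)..π, Real.cos (t * Real.cos θ) * w θ : ℝ) +
        (∫ θ in (0:ℝ)..π, Real.sin (t * Real.cos θ) * w θ : ℝ) * Complex.I := by
  rw [← intervalIntegral.integral_ofReal, ← intervalIntegral.integral_ofReal,
    ← intervalIntegral.integral_mul_const, ← intervalIntegral.integral_add
      ((by fun_prop : Continuous _).intervalIntegrable _ _)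
      ((by fun_prop : Continuous _).intervalIntegrable _ _)]
  congr 1 with θ
  rw [← Complex.ofReal_mul, Complex.exp_mul_I, ← Complex.ofReal_cos, ← Complex.ofReal_sin]
  push_cast
  ring

lemma tendsto_integral_cos_mul_cos {w : ℝ → ℝ} (hw : Continuous w) :
    Tendsto (fun t : ℝ => ∫ θ in (0:ℝ)..π, Real.cos (t * Real.cos θ) * w θ) atTop (nhds 0) := by
  have h := (Complex.continuous_re.tendsto 0).comp (tendsto_integral_cexp_mul_cos w)
  refine h.congr fun t => ?_
  rw [Function.comp_apply, integral_cexp_mul_cos_eq hw]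
  simp

lemma tendsto_integral_sin_mul_cos {w : ℝ → ℝ} (hw : Continuous w) :
    Tendsto (fun t : ℝ => ∫ θ in (0:ℝ)..π, Real.sin (t * Real.cos θ) * w θ) atTop (nhds 0) := by
  have h := (Complex.continuous_im.tendsto 0).comp (tendsto_integral_cexp_mul_cos w)
  refine h.congr fun t => ?_
  rw [Function.comp_apply, integral_cexp_mul_cos_eq hw]
  simp

lemma tendsto_poissonIntegral (n : ℕ) : Tendsto (poissonIntegral n) atTop (nhds 0) :=
  tendsto_integral_cos_mul_cos (by fun_prop)

lemma tendsto_mul_poissonIntegral (n : ℕ) :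
    Tendsto (fun t => t * poissonIntegral (n + 2) t) atTop (nhds 0) := by
  have h := (tendsto_integral_sin_mul_cos
    (w := fun θ => Real.cos θ * Real.sin θ ^ n) (by fun_prop)).const_mul ((n : ℝ) + 1)
  rw [mul_zero] at h
  refine h.congr fun t => ?_
  rw [← neg_inj, ← integral_sin_mul_cos_mul_cos_mul_sin_pow, intervalIntegral.integral_neg]
  ring

/-- An antiderivative of `t P_{n+2}(t)²` up to a constant factor. -/
noncomputable def poissonEnergy (n : ℕ) (t : ℝ) : ℝ :=
  (t * poissonIntegral (n + 2) t) ^ 2 + ((n + 1) * poissonIntegral n t) ^ 2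

lemma hasDerivAt_poissonEnergy (n : ℕ) (t : ℝ) :
    HasDerivAt (poissonEnergy n) (-(2 * (n + 1) * (t * poissonIntegral (n + 2) t ^ 2))) t := by
  have h := ((hasDerivAt_mul_poissonIntegral n t).pow 2).add
    (((hasDerivAt_poissonIntegral n t).const_mul ((n : ℝ) + 1)).pow 2)
  refine h.congr_deriv ?_
  field_simp
  ring

lemma tendsto_poissonEnergy (n : ℕ) : Tendsto (poissonEnergy n) atTop (nhds 0) := by
  simpa [funext (poissonEnergy.eq_1 n)] using ((tendsto_mul_poissonIntegral n).pow 2).add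
    (((tendsto_poissonIntegral n).const_mul ((n : ℝ) + 1)).pow 2)

lemma integral_mul_poissonIntegral_sq (n : ℕ) {b : ℝ} (hb : 0 < b) :
    ∫ s in Set.Ioi (0:ℝ), s * poissonIntegral (n + 2) (b * s) ^ 2 =
      (n + 1) * poissonIntegral n 0 ^ 2 / (2 * b ^ 2) := by
  have hd : ∀ s ∈ Set.Ici (0:ℝ), HasDerivAt
      (fun s => -(1 / (2 * (n + 1) * b ^ 2)) * poissonEnergy n (b * s))
      (s * poissonIntegral (n + 2) (b * s) ^ 2) s := fun s _ => by
    have h := ((hasDerivAt_poissonEnergy n (b * s)).comp s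
      ((hasDerivAt_id s).const_mul b)).const_mul (-(1 / (2 * ((n : ℝ) + 1) * b ^ 2)))
    refine h.congr_deriv ?_
    field_simp
  have hl : Tendsto (fun s => -(1 / (2 * ((n : ℝ) + 1) * b ^ 2)) * poissonEnergy n (b * s))
      atTop (nhds 0) := by
    have h := ((tendsto_poissonEnergy n).comp
      (tendsto_id.const_mul_atTop hb)).const_mul (-(1 / (2 * ((n : ℝ) + 1) * b ^ 2)))
    rwa [mul_zero] at h
  rw [integral_Ioi_of_hasDerivAt_of_nonneg' hd
    (fun s hs => mul_nonneg (le_of_lt hs) (sq_nonneg _)) hl]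
  simp only [poissonEnergy, mul_zero]
  field_simp
  ring

lemma poissonIntegral_zero_add_two (n : ℕ) :
    ((n : ℝ) + 2) * poissonIntegral (n + 2) 0 = (n + 1) * poissonIntegral n 0 := by
  have h := mul_integral_sin_mul_cos_mul_cos_mul_sin_pow n 0
  linarith

lemma poissonIntegral_zero (n : ℕ) :
    poissonIntegral n 0 = Real.sqrt π * Real.Gamma ((n + 1) / 2) / Real.Gamma (n / 2 + 1) := by
  induction n using Nat.twoStepInduction with
  | zero =>
    have h : Real.Gamma 2⁻¹ = Real.sqrt π := by rw [← one_div, Real.Gamma_one_half_eq]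
    simp [poissonIntegral, h, pi_pos.le]
  | one =>
    have h := Real.Gamma_add_one (s := 1 / 2) (by norm_num)
    rw [Real.Gamma_one_half_eq] at h
    have hp : Real.sqrt π ≠ 0 := by positivity
    norm_num [poissonIntegral, h]
    norm_num at h
    rw [h]
    field_simp
  | more n ih _ =>
    have h := poissonIntegral_zero_add_two n
    rw [ih] at h
    have h1 := Real.Gamma_add_one (s := ((n : ℝ) + 1) / 2) (by positivity)
    have h2 := Real.Gamma_add_one (s := (n : ℝ) / 2 + 1) (by positivity)
    have h3 : Real.Gamma ((n : ℝ) / 2 + 1) ≠ 0 := (Real.Gamma_pos_of_pos (by positivity)).ne'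
    rw [show (((n + 2 : ℕ) : ℝ) + 1) / 2 = ((n : ℝ) + 1) / 2 + 1 by push_cast; ring,
      show ((n + 2 : ℕ) : ℝ) / 2 + 1 = (n : ℝ) / 2 + 1 + 1 by push_cast; ring, h1, h2]
    field_simp at h ⊢
    linear_combination h

lemma rpow_mul_besselJ (d : ℕ) {r : ℝ} (hr : 0 < r) :
    r ^ (-(d : ℝ) / 2) * besselJ ((d : ℝ) / 2) r =
      poissonIntegral d r / (2 ^ ((d : ℝ) / 2) * (Real.sqrt π * Real.Gamma (((d : ℝ) + 1) / 2))) := by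
  have e : (2 : ℝ) * ((d : ℝ) / 2) = d := by ring
  simp only [besselJ, e, Real.rpow_natCast]
  rw [← poissonIntegral, Real.div_rpow hr.le (by norm_num), neg_div, Real.rpow_neg hr.le, add_div]
  have : r ^ ((d : ℝ) / 2) ≠ 0 := by positivity
  field_simp

lemma abs_poissonIntegral_le (n : ℕ) (t : ℝ) : |poissonIntegral n t| ≤ π := by
  have h := intervalIntegral.norm_integral_le_of_norm_le_const (a := 0) (b := π) (C := 1)
    (f := fun θ => Real.cos (t * Real.cos θ) * Real.sin θ ^ n) fun θ _ => by
      rw [norm_mul, norm_pow]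
      exact mul_le_one₀ (Real.abs_cos_le_one _) (by positivity)
        (pow_le_one₀ (abs_nonneg _) (Real.abs_sin_le_one _))
  simpa [poissonIntegral, abs_of_pos pi_pos] using h

lemma integrableOn_poissonIntegral_div_sq (n : ℕ) :
    IntegrableOn (fun t => poissonIntegral n t / t ^ 2) (Set.Ioi 1) := by
  refine Integrable.mono' (g := fun t => π * t ^ (-2 : ℝ))
    ((integrableOn_Ioi_rpow_of_lt (by norm_num) one_pos).const_mul π) ?_ ?_
  · exact ((continuous_poissonIntegral n).measurable.div (by fun_prop)).aestronglyMeasurable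
  · refine (ae_restrict_iff' measurableSet_Ioi).2 (ae_of_all _ fun t ht => ?_)
    have ht' : (0 : ℝ) < t := one_pos.trans ht
    rw [Real.rpow_neg ht'.le, Real.rpow_two, norm_div, norm_pow, Real.norm_eq_abs,
      Real.norm_eq_abs, sq_abs, ← div_eq_mul_inv]
    gcongr
    exact abs_poissonIntegral_le n t

lemma exists_tendsto_integral_poissonIntegral (n : ℕ) :
    ∃ L : ℝ, Tendsto (fun R => ∫ t in (1:ℝ)..R, poissonIntegral (n + 2) t) atTop (nhds L) := by
  have h1 := intervalIntegral_tendsto_integral_Ioi 1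
    (integrableOn_poissonIntegral_div_sq n) tendsto_id
  have h2 : Tendsto (fun R => poissonIntegral n R / R) atTop (nhds 0) :=
    (tendsto_poissonIntegral n).div_atTop tendsto_id
  refine ⟨_, (((h2.sub_const (poissonIntegral n 1)).add h1).const_mul (-((n : ℝ) + 1))).congr' ?_⟩
  filter_upwards [eventually_ge_atTop 1] with R hR
  have hne : ∀ t ∈ Set.uIcc 1 R, t ≠ 0 := fun t ht => by
    rw [Set.uIcc_of_le hR] at ht
    linarith [ht.1]
  have hi : IntervalIntegrable (fun t => poissonIntegral n t / t ^ 2) volume 1 R :=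
    ContinuousOn.intervalIntegrable ((continuous_poissonIntegral n).continuousOn.div
      (by fun_prop) fun t ht => pow_ne_zero 2 (hne t ht))
  have hd : ∀ t ∈ Set.uIcc 1 R, HasDerivAt (fun t => poissonIntegral n t / t)
      (-(1 / ((n : ℝ) + 1)) * poissonIntegral (n + 2) t - poissonIntegral n t / t ^ 2) t :=
      fun t ht => by
    have := hne t ht
    refine ((hasDerivAt_poissonIntegral n t).div (hasDerivAt_id t) this).congr_deriv ?_
    simp only [id]
    field_simp
  have hc := ((continuous_poissonIntegral (n + 2)).const_mul
    (-(1 / ((n : ℝ) + 1)))).intervalIntegrable (μ := volume) 1 R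
  have h := intervalIntegral.integral_eq_sub_of_hasDerivAt hd (hc.sub hi)
  rw [intervalIntegral.integral_sub hc hi, intervalIntegral.integral_const_mul] at h
  simp only [id, div_one] at h ⊢
  have h' : (∫ t in (1:ℝ)..R, poissonIntegral (n + 2) t) = -((n : ℝ) + 1) *
      (-(1 / ((n : ℝ) + 1)) * ∫ t in (1:ℝ)..R, poissonIntegral (n + 2) t) := by
    field_simp
  rw [h']
  linear_combination ((n : ℝ) + 1) * h

lemma exists_mfun_eq (n : ℕ) : ∃ L : ℝ, ∀ x : ℝ, 0 < x →
    mfun (n + 2) x = (1 / π) * (L - ∫ t in (1:ℝ)..(2 * π * x), poissonIntegral (n + 2) t) := by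
  obtain ⟨L, hL⟩ := exists_tendsto_integral_poissonIntegral n
  refine ⟨L, fun x hx => ?_⟩
  have hi := fun a b => (continuous_poissonIntegral (n + 2)).intervalIntegrable (μ := volume) a b
  set c : ℝ := 2 ^ (((n + 2 : ℕ) : ℝ) / 2) *
    (Real.sqrt π * Real.Gamma ((((n + 2 : ℕ) : ℝ) + 1) / 2)) with hc
  have h : Tendsto (fun R : ℝ => ∫ r in (2 * π * x)..R, r ^ (-((n + 2 : ℕ) : ℝ) / 2) *
      besselJ (((n + 2 : ℕ) : ℝ) / 2) r) atTop
      (nhds ((L - ∫ t in (1:ℝ)..(2 * π * x), poissonIntegral (n + 2) t) / c)) := by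
    refine ((hL.sub_const _).div_const c).congr' ?_
    filter_upwards [eventually_ge_atTop (2 * π * x)] with R hR
    rw [intervalIntegral.integral_interval_sub_left (hi _ _) (hi _ _),
      ← intervalIntegral.integral_div]
    refine intervalIntegral.integral_congr fun r hr => ?_
    rw [Set.uIcc_of_le hR] at hr
    exact (rpow_mul_besselJ (n + 2) (lt_of_lt_of_le (by positivity) hr.1)).symm
  have hΓ : Real.Gamma ((((n + 2 : ℕ) : ℝ) + 1) / 2) ≠ 0 :=
    (Real.Gamma_pos_of_pos (by positivity)).ne'
  rw [mfun, h.limUnder_eq, hc]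
  have hp := Real.sq_sqrt pi_pos.le
  have h2 : (2 : ℝ) ^ (((n + 2 : ℕ) : ℝ) / 2) ≠ 0 := by positivity
  have hp' : Real.sqrt π ≠ 0 := by positivity
  field_simp
  rw [hp]

lemma deriv_mfun_mul (n : ℕ) {r s : ℝ} (hr : 0 < r) (hs : 0 < s) :
    deriv (fun u : ℝ => mfun (n + 2) (u * r)) s =
      -(2 * r * poissonIntegral (n + 2) (2 * π * r * s)) := by
  obtain ⟨L, hL⟩ := exists_mfun_eq n
  have he : (fun u : ℝ => mfun (n + 2) (u * r)) =ᶠ[nhds s] fun u =>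
      (1 / π) * (L - ∫ t in (1:ℝ)..(2 * π * r * u), poissonIntegral (n + 2) t) := by
    filter_upwards [lt_mem_nhds hs] with u hu
    rw [hL _ (mul_pos hu hr), show 2 * π * (u * r) = 2 * π * r * u by ring]
  have hc := continuous_poissonIntegral (n + 2)
  have h := (hc.integral_hasStrictDerivAt 1 (2 * π * r * s)).hasDerivAt
  refine he.deriv_eq.trans (((h.comp s ((hasDerivAt_id s).const_mul (2 * π * r))).const_sub
    L).const_mul (1 / π)).deriv |>.trans ?_
  field_simp

lemma Gamma_add_one_half_sq_le {x : ℝ} (hx : 0 < x) :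
    Real.Gamma (x + 1 / 2) ^ 2 ≤ x * Real.Gamma x ^ 2 := by
  have h := Real.Gamma_mul_add_mul_le_rpow_Gamma_mul_rpow_Gamma hx (t := x + 1) (by positivity)
    (a := 1 / 2) (b := 1 / 2) (by norm_num) (by norm_num) (by norm_num)
  have hg := Real.Gamma_pos_of_pos hx
  rw [show 1 / 2 * x + 1 / 2 * (x + 1) = x + 1 / 2 by ring, Real.Gamma_add_one hx.ne',
    ← Real.mul_rpow (by positivity) (by positivity), ← Real.sqrt_eq_rpow] at h
  have h' := pow_le_pow_left₀ (Real.Gamma_pos_of_pos (by positivity)).le h 2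
  rw [Real.sq_sqrt (by positivity)] at h'
  linarith

lemma gamma_ratio_le_half {d : ℕ} (hd : 2 ≤ d) :
    (2 / π) * Real.Gamma (((d : ℝ) + 1) / 2) ^ 2 /
      (((d : ℝ) - 1) * Real.Gamma ((d : ℝ) / 2) ^ 2) ≤ 1 / 2 := by
  obtain rfl | hd := hd.eq_or_lt
  · have h := Real.Gamma_add_one (s := 1 / 2) (by norm_num)
    rw [Real.Gamma_one_half_eq] at h
    norm_num at h ⊢
    rw [h, mul_pow, Real.sq_sqrt pi_pos.le]
    field_simp
    norm_num
  · have hd3 : (3 : ℝ) ≤ d := by exact_mod_cast hd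
    have h := Gamma_add_one_half_sq_le (x := (d : ℝ) / 2) (by positivity)
    have hg : 0 < Real.Gamma ((d : ℝ) / 2) := Real.Gamma_pos_of_pos (by positivity)
    have hd1 : (0 : ℝ) < d - 1 := by linarith
    rw [← add_div] at h
    rw [div_le_iff₀ (by positivity), div_mul_eq_mul_div, div_le_iff₀ pi_pos]
    have hc : (2 : ℝ) * d ≤ (d - 1) * π := by nlinarith [pi_gt_three]
    nlinarith [mul_le_mul_of_nonneg_right hc (sq_nonneg (Real.Gamma ((d : ℝ) / 2)))]

/-- Let `d ≥ 2` and `r > 0`. Then `∫₀^∞ |s · (d/ds) m(sr)|² ds/s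
= (2/π) Γ((d+1)/2)² / ((d−1) Γ(d/2)²)`, and this quantity is at most `1/2`. -/
theorem statement16 (d : ℕ) (hd : 2 ≤ d) (r : ℝ) (hr : 0 < r) :
    (∫ s in Set.Ioi (0:ℝ), |s * deriv (fun u : ℝ => mfun d (u * r)) s| ^ 2 / s) =
      (2 / π) * Real.Gamma (((d : ℝ) + 1) / 2) ^ 2 /
        (((d : ℝ) - 1) * Real.Gamma ((d : ℝ) / 2) ^ 2) ∧
    (∫ s in Set.Ioi (0:ℝ), |s * deriv (fun u : ℝ => mfun d (u * r)) s| ^ 2 / s) ≤ 1 / 2 := by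
  have hmain : (∫ s in Set.Ioi (0:ℝ), |s * deriv (fun u : ℝ => mfun d (u * r)) s| ^ 2 / s) =
      (2 / π) * Real.Gamma (((d : ℝ) + 1) / 2) ^ 2 /
        (((d : ℝ) - 1) * Real.Gamma ((d : ℝ) / 2) ^ 2) := by
    obtain ⟨n, rfl⟩ := Nat.exists_eq_add_of_le' hd
    have hcongr : ∀ s ∈ Set.Ioi (0:ℝ),
        |s * deriv (fun u : ℝ => mfun (n + 2) (u * r)) s| ^ 2 / s =
          4 * r ^ 2 * (s * poissonIntegral (n + 2) (2 * π * r * s) ^ 2) := fun s hs => by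
      have hs' : s ≠ 0 := ne_of_gt hs
      rw [deriv_mfun_mul n hr hs, sq_abs]
      field_simp
      ring
    rw [setIntegral_congr_fun measurableSet_Ioi hcongr, integral_const_mul,
      integral_mul_poissonIntegral_sq n (by positivity), poissonIntegral_zero]
    have h1 := Real.Gamma_add_one (s := ((n : ℝ) + 1) / 2) (by positivity)
    have hg : Real.Gamma ((n : ℝ) / 2 + 1) ≠ 0 := (Real.Gamma_pos_of_pos (by positivity)).ne'
    rw [show (((n + 2 : ℕ) : ℝ) + 1) / 2 = ((n : ℝ) + 1) / 2 + 1 by push_cast; ring,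
      show ((n + 2 : ℕ) : ℝ) / 2 = (n : ℝ) / 2 + 1 by push_cast; ring,
      show ((n + 2 : ℕ) : ℝ) - 1 = (n : ℝ) + 1 by push_cast; ring, h1, div_pow, mul_pow,
      Real.sq_sqrt pi_pos.le]
    field_simp
    norm_num
  exact ⟨hmain, hmain.trans_le (gamma_ratio_le_half hd)⟩
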